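/- arXiv:math/0101178 — 3 statements merged into one kernel-verified Lean document; each statement's English description precedes it below -/
import Mathlib

section
/- Let q ∈ (0,1) and let Z be the operator on ℓ²(ℕ) defined on the standard orthonormal basis (e_n) by Z e_n = √(1−q^{2n+2}) e_{n+1}. Then Z is bounded, satisfies the quantum-disc relation Z*Z = q² Z Z* + (1−q²)·I, and the spectrum of the self-adjoint operator Y = I − Z Z* equals {0} ∪ {q^{2n} : n ∈ ℕ}. -/
open scoped BigOperators

noncomputable section

/-- The Hilbert space ℓ²(ℕ) of square-summable complex sequences. -/
abbrev EllTwo : Type := lp (fun _ : ℕ => ℂ) 2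

/-- The standard orthonormal basis vector `e n` of `ℓ²(ℕ)`. -/
noncomputable def eVec (n : ℕ) : EllTwo := lp.single 2 n (1 : ℂ)

/-- The bounded operator on `ℓ²(ℕ)` multiplying the `n`-th coordinate by `a n`, for `a` bounded. -/
def diagonalCLM (a : ℕ → ℂ) (C : ℝ) (h : ∀ n, ‖a n‖ ≤ C) : EllTwo →L[ℂ] EllTwo :=
  have hle (f : EllTwo) (n : ℕ) : ‖a n * f n‖ ≤ ‖((C : ℂ) • f) n‖ := by
    simp only [lp.coeFn_smul, Pi.smul_apply, norm_smul, norm_mul, Complex.norm_real]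
    gcongr
    exact (h n).trans (le_abs_self C)
  LinearMap.mkContinuous
    { toFun := fun f => ⟨fun n => a n * f n, (lp.memℓp ((C : ℂ) • f)).mono' (hle f)⟩
      map_add' := fun f g => by ext n; exact mul_add _ _ _
      map_smul' := fun c f => by ext n; exact mul_left_comm _ _ _ }
    |C| fun f => by
      refine (lp.norm_mono (y := (C : ℂ) • f) (by norm_num) (hle f)).trans ?_
      rw [norm_smul, Complex.norm_real, Real.norm_eq_abs]

theorem diagonalCLM_apply (a : ℕ → ℂ) (C : ℝ) (h : ∀ n, ‖a n‖ ≤ C) (f : EllTwo) (n : ℕ) :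
    diagonalCLM a C h f n = a n * f n :=
  rfl

theorem eVec_apply (m n : ℕ) : eVec m n = if n = m then 1 else 0 := by
  simp [eVec, lp.single_apply, Pi.single_apply]

theorem inner_eVec_left (n : ℕ) (f : EllTwo) : inner ℂ (eVec n) f = f n := by
  simp [eVec, lp.inner_single_left]

theorem orthonormal_eVec : Orthonormal ℂ eVec := by
  rw [orthonormal_iff_ite]
  intro i j
  rw [inner_eVec_left, eVec_apply]

theorem diagonalCLM_eVec (a : ℕ → ℂ) (C : ℝ) (h : ∀ n, ‖a n‖ ≤ C) (n : ℕ) :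
    diagonalCLM a C h (eVec n) = a n • eVec n := by
  ext m
  rw [diagonalCLM_apply, lp.coeFn_smul, Pi.smul_apply, eVec_apply, smul_eq_mul]
  split_ifs with hm
  · rw [hm]
  · simp

theorem continuousLinearMap_ext_eVec {S T : EllTwo →L[ℂ] EllTwo}
    (h : ∀ n, S (eVec n) = T (eVec n)) : S = T := by
  refine lp.ext_continuousLinearMap (by norm_num) fun n => ?_
  ext1
  exact h n

/-- The unilateral shift on `ℓ²(ℕ)` is bounded: `e n ↦ e (n + 1)`. -/
theorem exists_shift : ∃ S : EllTwo →L[ℂ] EllTwo, ∀ n, S (eVec n) = eVec (n + 1) := by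
  have ho : Orthonormal ℂ fun n => eVec (n + 1) :=
    orthonormal_eVec.comp _ (add_left_injective 1)
  refine ⟨ho.orthogonalFamily.linearIsometry.toContinuousLinearMap, fun n => ?_⟩
  simp [eVec, OrthogonalFamily.linearIsometry_apply_single]

/-- A weighted shift with bounded weights is a bounded operator. -/
theorem exists_weightedShift (w : ℕ → ℂ) (C : ℝ) (h : ∀ n, ‖w n‖ ≤ C) :
    ∃ Z : EllTwo →L[ℂ] EllTwo, ∀ n, Z (eVec n) = w n • eVec (n + 1) := by
  obtain ⟨S, hS⟩ := exists_shift
  exact ⟨S ∘L diagonalCLM w C h, fun n => by simp [diagonalCLM_eVec, hS]⟩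

section WeightedShift

variable {Z : EllTwo →L[ℂ] EllTwo} {w : ℕ → ℝ}

theorem adjoint_weightedShift_apply (hZ : ∀ n, Z (eVec n) = (w n : ℂ) • eVec (n + 1))
    (f : EllTwo) (n : ℕ) : ContinuousLinearMap.adjoint Z f n = w n * f (n + 1) := by
  rw [← inner_eVec_left, ContinuousLinearMap.adjoint_inner_right, hZ, inner_smul_left,
    inner_eVec_left, Complex.conj_ofReal]

theorem adjoint_weightedShift_eVec_zero (hZ : ∀ n, Z (eVec n) = (w n : ℂ) • eVec (n + 1)) :
    ContinuousLinearMap.adjoint Z (eVec 0) = 0 := by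
  ext n
  simp [adjoint_weightedShift_apply hZ, eVec_apply]

theorem adjoint_weightedShift_eVec_succ (hZ : ∀ n, Z (eVec n) = (w n : ℂ) • eVec (n + 1))
    (n : ℕ) : ContinuousLinearMap.adjoint Z (eVec (n + 1)) = (w n : ℂ) • eVec n := by
  ext m
  rw [adjoint_weightedShift_apply hZ, lp.coeFn_smul, Pi.smul_apply, eVec_apply, eVec_apply,
    smul_eq_mul]
  by_cases hm : m = n <;> simp [hm]

end WeightedShift

theorem eVec_ne_zero (n : ℕ) : eVec n ≠ 0 :=
  orthonormal_eVec.ne_zero n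

theorem mem_spectrum_of_apply_eVec {T : EllTwo →L[ℂ] EllTwo} {μ : ℂ} {n : ℕ}
    (h : T (eVec n) = μ • eVec n) : μ ∈ spectrum ℂ T := by
  rw [spectrum.mem_iff]
  rintro ⟨u, hu⟩
  apply eVec_ne_zero n
  have hker : (u : EllTwo →L[ℂ] EllTwo) (eVec n) = 0 := by
    rw [hu]
    simp [h, Algebra.algebraMap_eq_smul_one]
  calc eVec n = ((u⁻¹ : (EllTwo →L[ℂ] EllTwo)ˣ) * u : EllTwo →L[ℂ] EllTwo) (eVec n) := by
        rw [u.inv_mul, one_apply_eq_self]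
    _ = 0 := by rw [mul_apply_eq_comp, hker, map_zero]

/-- The spectrum of an operator that is diagonal in the standard basis, with eigenvalues
tending to `0`. -/
theorem spectrum_eq_of_apply_eVec {T : EllTwo →L[ℂ] EllTwo} {μ : ℕ → ℂ}
    (hT : ∀ n, T (eVec n) = μ n • eVec n)
    (hμ : Filter.Tendsto μ Filter.atTop (nhds 0)) :
    spectrum ℂ T = {0} ∪ Set.range μ := by
  have hmem (n : ℕ) : μ n ∈ spectrum ℂ T := mem_spectrum_of_apply_eVec (hT n)
  apply Set.Subset.antisymm
  · intro z hz
    by_contra hnot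
    simp only [Set.mem_union, Set.mem_singleton_iff, Set.mem_range, not_or, not_exists] at hnot
    obtain ⟨hz0, hzμ⟩ := hnot
    have hne (n : ℕ) : z - μ n ≠ 0 := sub_ne_zero.2 (Ne.symm (hzμ n))
    have hlim : Filter.Tendsto (fun n => (z - μ n)⁻¹) Filter.atTop (nhds (z - 0)⁻¹) :=
      (tendsto_const_nhds.sub hμ).inv₀ (by simpa using hz0)
    obtain ⟨C, hC⟩ := (Metric.isBounded_range_of_tendsto _ hlim).exists_norm_le
    have hC' (n : ℕ) : ‖(z - μ n)⁻¹‖ ≤ C := hC _ ⟨n, rfl⟩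
    refine hz ⟨⟨algebraMap ℂ _ z - T, diagonalCLM _ C hC', ?_, ?_⟩, rfl⟩
    · refine continuousLinearMap_ext_eVec fun n => ?_
      simp [diagonalCLM_eVec, hT, Algebra.algebraMap_eq_smul_one, ← sub_smul, smul_smul, hne n]
    · refine continuousLinearMap_ext_eVec fun n => ?_
      simp [diagonalCLM_eVec, hT, Algebra.algebraMap_eq_smul_one, ← sub_smul, smul_smul, hne n]
  · rintro z (rfl | ⟨n, rfl⟩)
    · exact (spectrum.isClosed T).mem_of_tendsto hμ (.of_forall hmem)
    · exact hmem n

/-- For `q ∈ (0,1)` there is a bounded operator `Z` on `ℓ²(ℕ)` with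
`Z e_n = √(1−q^{2n+2}) e_{n+1}`; it satisfies the quantum-disc relation
`Z*Z = q² Z Z* + (1−q²)·I`, and the spectrum of `Y = I − Z Z*` is
`{0} ∪ {q^{2n} : n ∈ ℕ}`. -/
theorem quantum_disc_representation (q : ℝ) (hq : q ∈ Set.Ioo (0 : ℝ) 1) :
    ∃ Z : EllTwo →L[ℂ] EllTwo,
      (∀ n : ℕ, Z (eVec n) = (Real.sqrt (1 - q ^ (2 * n + 2)) : ℂ) • eVec (n + 1)) ∧
      ContinuousLinearMap.adjoint Z ∘L Z
        = ((q : ℂ) ^ 2) • (Z ∘L ContinuousLinearMap.adjoint Z)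
          + ((1 : ℂ) - (q : ℂ) ^ 2) • (1 : EllTwo →L[ℂ] EllTwo) ∧
      IsSelfAdjoint ((1 : EllTwo →L[ℂ] EllTwo) - Z ∘L ContinuousLinearMap.adjoint Z) ∧
      spectrum ℂ ((1 : EllTwo →L[ℂ] EllTwo) - Z ∘L ContinuousLinearMap.adjoint Z)
        = {0} ∪ Set.range (fun n : ℕ => ((q ^ (2 * n) : ℝ) : ℂ)) := by
  obtain ⟨hq0, hq1⟩ := hq
  have hsq (n : ℕ) : ((Real.sqrt (1 - q ^ (2 * n + 2)) : ℝ) : ℂ)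
      * ((Real.sqrt (1 - q ^ (2 * n + 2)) : ℝ) : ℂ) = 1 - (q : ℂ) ^ (2 * n + 2) := by
    rw [← Complex.ofReal_mul, Real.mul_self_sqrt (sub_nonneg.2 (pow_le_one₀ hq0.le hq1.le))]
    push_cast
    rfl
  obtain ⟨Z, hZ⟩ := exists_weightedShift
    (fun n => ((Real.sqrt (1 - q ^ (2 * n + 2)) : ℝ) : ℂ)) 1 fun n => by
      rw [Complex.norm_real, Real.norm_of_nonneg (Real.sqrt_nonneg _), Real.sqrt_le_iff]
      refine ⟨zero_le_one, ?_⟩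
      linarith [pow_nonneg hq0.le (2 * n + 2)]
  have h0 := adjoint_weightedShift_eVec_zero hZ
  have h1 := adjoint_weightedShift_eVec_succ hZ
  refine ⟨Z, hZ, continuousLinearMap_ext_eVec fun n => ?_, ?_, spectrum_eq_of_apply_eVec ?_ ?_⟩
  · cases n with
    | zero =>
      simp only [ContinuousLinearMap.comp_apply, add_apply, smul_apply, one_apply_eq_self, hZ, h0,
        h1, map_smul, map_zero, smul_zero, zero_add, smul_smul, mul_zero]
      simpa only [mul_zero, zero_add] using congrArg (· • eVec 0) (hsq 0)
    | succ n =>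
      simp only [ContinuousLinearMap.comp_apply, add_apply, smul_apply, one_apply_eq_self, hZ,
        h1, map_smul, smul_smul, hsq, ← add_smul]
      congr 1
      ring
  · exact (IsSelfAdjoint.one _).sub (IsSelfAdjoint.mul_star_self Z)
  · rintro (_ | n)
    · simp [h0]
    · simp only [ContinuousLinearMap.comp_apply, sub_apply,
        one_apply_eq_self, hZ, h1, map_smul, smul_smul, hsq]
      push_cast
      module
  · have hlim : Filter.Tendsto (fun n : ℕ => q ^ (2 * n)) Filter.atTop (nhds 0) := by
      simp_rw [pow_mul]
      exact tendsto_pow_atTop_nhds_zero_of_lt_one (by positivity)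
        (pow_lt_one₀ hq0.le hq1 two_ne_zero)
    exact_mod_cast (Complex.continuous_ofReal.tendsto 0).comp hlim

end
end

section
/- The operator Δ (the radial part of the q-invariant Laplacian) defines a bounded self-adjoint operator on the Hilbert space L²(dν)q⁰, and this operator is invertible with bounded inverse. -/
open scoped BigOperators ENNReal

noncomputable section

/-- The radial part of the q-invariant Laplacian, acting on sequences
`f : ℕ → ℂ` (where `f m` stands for `f(q^{2m})`):
`(Δf)(q^{2m}) = q^{-1} q^{4m} [A_m - B_m] / (q^{2m-1}−q^{2m+1})`, where
`A_m = (1−q^{2m})·(f(q^{2m-2})−f(q^{2m}))/(q^{2m-2}−q^{2m})` (set to `0` for `m = 0`) and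
`B_m = (1−q^{2m+2})·(f(q^{2m})−f(q^{2m+2}))/(q^{2m}−q^{2m+2})`. -/
noncomputable def DeltaQ (q : ℝ) (f : ℕ → ℂ) : ℕ → ℂ := fun m =>
  (q : ℂ) ^ (-1 : ℤ) * (q : ℂ) ^ (4 * (m : ℤ)) *
    ((if m = 0 then 0 else
        (1 - (q : ℂ) ^ (2 * (m : ℤ))) * (f (m - 1) - f m) /
          ((q : ℂ) ^ (2 * (m : ℤ) - 2) - (q : ℂ) ^ (2 * (m : ℤ)))) -
      (1 - (q : ℂ) ^ (2 * (m : ℤ) + 2)) * (f m - f (m + 1)) /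
        ((q : ℂ) ^ (2 * (m : ℤ)) - (q : ℂ) ^ (2 * (m : ℤ) + 2))) /
    ((q : ℂ) ^ (2 * (m : ℤ) - 1) - (q : ℂ) ^ (2 * (m : ℤ) + 1))

/-- The weighted counting measure on ℕ with `ν {m} = (1−q²) q^{-2m}`, so that
`MeasureTheory.Lp ℂ 2 (nuMeasure q)` is the Hilbert space `L²(dν)q⁰` of sequences with inner
product `⟨f,g⟩ = (1−q²) Σ_{m≥0} conj(g(q^{2m})) f(q^{2m}) q^{-2m}`. -/
noncomputable def nuMeasure (q : ℝ) : MeasureTheory.Measure ℕ :=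
  MeasureTheory.Measure.count.withDensity
    (fun m => ENNReal.ofReal ((1 - q ^ 2) * q ^ (-(2 * (m : ℤ)))))

open MeasureTheory

lemma nuMeasure_apply (q : ℝ) (s : Set ℕ) :
    nuMeasure q s =
      ∑' m, s.indicator (fun m => ENNReal.ofReal ((1 - q ^ 2) * q ^ (-(2 * (m : ℤ))))) m := by
  rw [nuMeasure, withDensity_apply _ s.to_countable.measurableSet,
    ← lintegral_indicator s.to_countable.measurableSet, lintegral_count]

lemma nuMeasure_singleton (q : ℝ) (m : ℕ) :
    nuMeasure q {m} = ENNReal.ofReal ((1 - q ^ 2) * q ^ (-(2 * (m : ℤ)))) := by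
  rw [nuMeasure_apply, tsum_eq_single m fun n hn => by simp [hn]]
  simp

lemma nuMeasure_singleton_ne_top (q : ℝ) (m : ℕ) : nuMeasure q {m} ≠ ∞ := by
  rw [nuMeasure_singleton]
  exact ENNReal.ofReal_ne_top

lemma nuMeasure_weight_pos {q : ℝ} (hq : q ∈ Set.Ioo (0 : ℝ) 1) (m : ℕ) :
    0 < (1 - q ^ 2) * q ^ (-(2 * (m : ℤ))) := by
  have h : q ^ 2 < 1 := pow_lt_one₀ hq.1.le hq.2 two_ne_zero
  exact mul_pos (by linarith) (zpow_pos hq.1 _)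

lemma nuMeasure_weight_succ {q : ℝ} (hq : q ≠ 0) (m : ℕ) :
    (1 - q ^ 2) * q ^ (-(2 * (m : ℤ))) =
      q ^ 2 * ((1 - q ^ 2) * q ^ (-(2 * ((m + 1 : ℕ) : ℤ)))) := by
  have : q ^ (-(2 * (m : ℤ))) = q ^ (-(2 * ((m + 1 : ℕ) : ℤ))) * q ^ 2 := by
    rw [← zpow_natCast q 2, ← zpow_add₀ hq]
    congr 1
    push_cast
    ring
  rw [this]
  ring

lemma measureReal_nuMeasure_singleton {q : ℝ} (hq : q ∈ Set.Ioo (0 : ℝ) 1) (m : ℕ) :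
    (nuMeasure q).real {m} = (1 - q ^ 2) * q ^ (-(2 * (m : ℤ))) := by
  rw [measureReal_def, nuMeasure_singleton, ENNReal.toReal_ofReal (nuMeasure_weight_pos hq m).le]

lemma ae_nuMeasure_iff {q : ℝ} (hq : q ∈ Set.Ioo (0 : ℝ) 1) {P : ℕ → Prop} :
    (∀ᵐ m ∂nuMeasure q, P m) ↔ ∀ m, P m := by
  refine ⟨fun h m => ?_, fun h => ae_of_all _ h⟩
  by_contra hm
  have h0 : nuMeasure q {m} = 0 :=
    measure_mono_null (Set.singleton_subset_iff.2 hm) (ae_iff.1 h)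
  rw [nuMeasure_singleton, ENNReal.ofReal_eq_zero] at h0
  exact (nuMeasure_weight_pos hq m).not_ge h0

lemma map_succ_nuMeasure_le {q : ℝ} (hq : q ≠ 0) :
    (nuMeasure q).map Nat.succ ≤ ENNReal.ofReal (q ^ 2) • nuMeasure q := by
  refine Measure.le_iff.2 fun s hs => ?_
  rw [Measure.map_apply (measurable_of_countable _) hs, Measure.smul_apply, smul_eq_mul,
    nuMeasure_apply, nuMeasure_apply, ← ENNReal.tsum_mul_left]
  refine le_trans (ENNReal.tsum_le_tsum fun m => ?_)
    (ENNReal.tsum_comp_le_tsum_of_injective Nat.succ_injective _)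
  by_cases hm : m.succ ∈ s
  · rw [Set.indicator_of_mem (by exact hm), Set.indicator_of_mem hm, nuMeasure_weight_succ hq,
      ENNReal.ofReal_mul (by positivity)]
  · rw [Set.indicator_of_notMem (by exact hm)]
    exact zero_le

lemma eLpNorm_comp_succ_le {q : ℝ} (hq : 0 < q) (f : ℕ → ℂ) :
    eLpNorm (fun m => f (m + 1)) 2 (nuMeasure q) ≤ ENNReal.ofReal q * eLpNorm f 2 (nuMeasure q) := by
  have hf : ∀ μ : Measure ℕ, AEStronglyMeasurable f μ := fun μ =>
    (measurable_of_countable f).aestronglyMeasurable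
  calc eLpNorm (fun m => f (m + 1)) 2 (nuMeasure q)
      = eLpNorm f 2 ((nuMeasure q).map Nat.succ) :=
        (eLpNorm_map_measure (hf _) (measurable_of_countable _).aemeasurable).symm
    _ ≤ eLpNorm f 2 (ENNReal.ofReal (q ^ 2) • nuMeasure q) :=
        eLpNorm_mono_measure f (map_succ_nuMeasure_le hq.ne')
    _ = ENNReal.ofReal q * eLpNorm f 2 (nuMeasure q) := by
        rw [eLpNorm_smul_measure_of_ne_zero (by simpa using hq.ne'), smul_eq_mul,
          ENNReal.ofReal_rpow_of_pos (by positivity), ← Real.rpow_natCast q 2,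
          ← Real.rpow_mul hq.le]
        norm_num

lemma exists_clm_of_eLpNorm_le {q : ℝ} (hq : q ∈ Set.Ioo (0 : ℝ) 1)
    (L : (ℕ → ℂ) →ₗ[ℂ] (ℕ → ℂ)) {c : ℝ} (hc : 0 ≤ c)
    (hL : ∀ f, eLpNorm (L f) 2 (nuMeasure q) ≤ ENNReal.ofReal c * eLpNorm f 2 (nuMeasure q)) :
    ∃ A : Lp ℂ 2 (nuMeasure q) →L[ℂ] Lp ℂ 2 (nuMeasure q),
      ‖A‖ ≤ c ∧ ∀ (f : Lp ℂ 2 (nuMeasure q)) (m : ℕ), A f m = L f m := by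
  have hmem (f : Lp ℂ 2 (nuMeasure q)) : MemLp (L f) 2 (nuMeasure q) :=
    ⟨(measurable_of_countable _).aestronglyMeasurable,
      (hL f).trans_lt (ENNReal.mul_lt_top ENNReal.ofReal_lt_top (Lp.eLpNorm_lt_top f))⟩
  have hcoe (f : Lp ℂ 2 (nuMeasure q)) (m : ℕ) : (hmem f).toLp (L f) m = L f m :=
    (ae_nuMeasure_iff hq).1 (hmem f).coeFn_toLp m
  let A : Lp ℂ 2 (nuMeasure q) →ₗ[ℂ] Lp ℂ 2 (nuMeasure q) :=
    { toFun := fun f => (hmem f).toLp (L f)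
      map_add' := fun f g => by
        rw [← MemLp.toLp_add, MemLp.toLp_eq_toLp_iff, ← map_add]
        rw [funext ((ae_nuMeasure_iff hq).1 (Lp.coeFn_add f g))]
      map_smul' := fun a f => by
        rw [RingHom.id_apply, ← MemLp.toLp_const_smul, MemLp.toLp_eq_toLp_iff, ← map_smul]
        rw [funext ((ae_nuMeasure_iff hq).1 (Lp.coeFn_smul a f))] }
  refine ⟨A.mkContinuous c fun f => ?_, A.mkContinuous_norm_le hc _, hcoe⟩
  change ‖(hmem f).toLp (L f)‖ ≤ c * ‖f‖
  rw [Lp.norm_toLp, Lp.norm_def]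
  refine (ENNReal.toReal_mono (by finiteness) (hL f)).trans_eq ?_
  rw [ENNReal.toReal_mul, ENNReal.toReal_ofReal hc]

lemma inner_indicatorConstLp_singleton {q : ℝ} (hq : q ∈ Set.Ioo (0 : ℝ) 1)
    (f : Lp ℂ 2 (nuMeasure q)) (m : ℕ) :
    inner ℂ (indicatorConstLp 2 (measurableSet_singleton m) (nuMeasure_singleton_ne_top q m) (1 : ℂ))
      f = (((1 - q ^ 2) * q ^ (-(2 * (m : ℤ))) : ℝ) : ℂ) * f m := by
  rw [L2.inner_indicatorConstLp_one, integral_singleton, measureReal_nuMeasure_singleton hq,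
    Complex.real_smul]

lemma adjoint_shift_apply {q : ℝ} (hq : q ∈ Set.Ioo (0 : ℝ) 1)
    {S : Lp ℂ 2 (nuMeasure q) →L[ℂ] Lp ℂ 2 (nuMeasure q)}
    (hS : ∀ (f : Lp ℂ 2 (nuMeasure q)) (m : ℕ), S f m = f (m + 1))
    (f : Lp ℂ 2 (nuMeasure q)) (m : ℕ) :
    star S f m = if m = 0 then 0 else (q : ℂ) ^ 2 * f (m - 1) := by
  have hne (k : ℕ) : (((1 - q ^ 2) * q ^ (-(2 * (k : ℤ))) : ℝ) : ℂ) ≠ 0 :=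
    Complex.ofReal_ne_zero.2 (nuMeasure_weight_pos hq k).ne'
  have hind (k n : ℕ) : (indicatorConstLp 2 (measurableSet_singleton k)
      (nuMeasure_singleton_ne_top q k) (1 : ℂ)) n = if n = k then 1 else 0 := by
    rw [(ae_nuMeasure_iff hq).1 indicatorConstLp_coeFn n, Set.indicator_apply]
    simp
  have key := inner_indicatorConstLp_singleton hq (star S f) m
  rw [ContinuousLinearMap.star_eq_adjoint, ContinuousLinearMap.adjoint_inner_right] at key
  refine mul_left_cancel₀ (hne m) (key.symm.trans ?_)
  rcases m with _ | m
  · have : S (indicatorConstLp 2 (measurableSet_singleton 0)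
        (nuMeasure_singleton_ne_top q 0) (1 : ℂ)) = 0 := by
      refine Lp.ext ((ae_nuMeasure_iff hq).2 fun n => ?_)
      rw [hS, hind, (ae_nuMeasure_iff hq).1 (Lp.coeFn_zero ℂ 2 (nuMeasure q)) n]
      simp
    rw [this]
    simp
  · have : S (indicatorConstLp 2 (measurableSet_singleton (m + 1))
        (nuMeasure_singleton_ne_top q (m + 1)) (1 : ℂ)) =
        indicatorConstLp 2 (measurableSet_singleton m)
          (nuMeasure_singleton_ne_top q m) (1 : ℂ) := by
      refine Lp.ext ((ae_nuMeasure_iff hq).2 fun n => ?_)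
      rw [hS, hind, hind]
      simp
    rw [this, inner_indicatorConstLp_singleton hq, nuMeasure_weight_succ hq.1.ne' m]
    simp only [Nat.add_eq_zero_iff, one_ne_zero, and_false, if_false, Nat.add_sub_cancel]
    push_cast
    ring

lemma isSelfAdjoint_of_apply_eq_mul {q : ℝ}
    {N : Lp ℂ 2 (nuMeasure q) →L[ℂ] Lp ℂ 2 (nuMeasure q)} {a : ℕ → ℝ}
    (hN : ∀ (f : Lp ℂ 2 (nuMeasure q)) (m : ℕ), N f m = a m * f m) : IsSelfAdjoint N := by
  rw [ContinuousLinearMap.isSelfAdjoint_iff_isSymmetric]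
  intro f g
  simp only [ContinuousLinearMap.coe_coe, L2.inner_def, hN, RCLike.inner_apply, map_mul,
    Complex.conj_ofReal]
  congr 1 with m
  ring

lemma deltaQ_eq {q : ℝ} (hq : q ∈ Set.Ioo (0 : ℝ) 1) (f : ℕ → ℂ) (m : ℕ) :
    DeltaQ q f m = -(((1 - q ^ 2) ^ 2 : ℝ) : ℂ)⁻¹ *
      ((1 - (q : ℂ) ^ (2 * m + 2)) * (f m - f (m + 1)) -
        if m = 0 then 0 else (q : ℂ) ^ 2 * ((1 - (q : ℂ) ^ (2 * m)) * (f (m - 1) - f m))) := by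
  have hq0 : (q : ℂ) ≠ 0 := Complex.ofReal_ne_zero.2 hq.1.ne'
  have hq1 : (1 : ℂ) - (q : ℂ) ^ 2 ≠ 0 := by
    have h : q ^ 2 < 1 := pow_lt_one₀ hq.1.le hq.2 two_ne_zero
    exact_mod_cast (sub_pos.2 h).ne'
  have e1 : (q : ℂ) ^ (2 * (m : ℤ)) = (q : ℂ) ^ (2 * m) := by norm_cast
  have e2 : (q : ℂ) ^ (4 * (m : ℤ)) = ((q : ℂ) ^ (2 * m)) ^ 2 := by
    rw [← pow_mul]; norm_cast; ring_nf
  have e3 : (q : ℂ) ^ (2 * (m : ℤ) + 2) = (q : ℂ) ^ (2 * m) * (q : ℂ) ^ 2 := by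
    rw [zpow_add₀ hq0, e1]; norm_cast
  have e4 : (q : ℂ) ^ (2 * (m : ℤ) + 1) = (q : ℂ) ^ (2 * m) * q := by
    rw [zpow_add₀ hq0, e1, zpow_one]
  have e5 : (q : ℂ) ^ (2 * (m : ℤ) - 1) = (q : ℂ) ^ (2 * m) * (q : ℂ)⁻¹ := by
    rw [sub_eq_add_neg, zpow_add₀ hq0, e1, zpow_neg_one]
  have e6 : (q : ℂ) ^ (2 * (m : ℤ) - 2) = (q : ℂ) ^ (2 * m) * ((q : ℂ) ^ 2)⁻¹ := by
    rw [sub_eq_add_neg, zpow_add₀ hq0, e1, zpow_neg]; norm_cast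
  have hx : (q : ℂ) ^ (2 * m) ≠ 0 := pow_ne_zero _ hq0
  rw [DeltaQ, e1, e2, e3, e4, e5, e6, zpow_neg_one, pow_add]
  generalize (q : ℂ) ^ (2 * m) = x at hx
  have d1 : x * ((q : ℂ) ^ 2)⁻¹ - x = x * (1 - (q : ℂ) ^ 2) / (q : ℂ) ^ 2 := by field_simp
  have d2 : x * (q : ℂ)⁻¹ - x * q = x * (1 - (q : ℂ) ^ 2) / q := by field_simp
  have d3 : x - x * (q : ℂ) ^ 2 = x * (1 - (q : ℂ) ^ 2) := by ring
  rw [d1, d2, d3]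
  push_cast
  split_ifs <;> field_simp <;> ring

/-- the radial part of the q-invariant Laplacian defines a bounded self-adjoint
operator on `L²(dν)q⁰` which is invertible with bounded inverse.  (Since every singleton has
positive `ν`-measure, elements of `Lp` are genuine sequences and the pointwise formula below
characterizes the operator.) -/
theorem deltaQ_bounded_selfAdjoint_invertible (q : ℝ) (hq : q ∈ Set.Ioo (0 : ℝ) 1) :
    ∃ T : MeasureTheory.Lp ℂ 2 (nuMeasure q) →L[ℂ] MeasureTheory.Lp ℂ 2 (nuMeasure q),
      (∀ f : MeasureTheory.Lp ℂ 2 (nuMeasure q), ∀ m : ℕ, (T f) m = DeltaQ q (⇑f) m) ∧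
      IsSelfAdjoint T ∧ IsUnit T := by
  have hq2 : q ^ 2 < 1 := pow_lt_one₀ hq.1.le hq.2 two_ne_zero
  obtain ⟨S, hS_norm, hS⟩ := exists_clm_of_eLpNorm_le hq
    (LinearMap.funLeft ℂ ℂ Nat.succ) hq.1.le (eLpNorm_comp_succ_le hq.1)
  obtain ⟨N, hN_norm, hN⟩ := exists_clm_of_eLpNorm_le hq
    (LinearMap.mulLeft ℂ fun m : ℕ => ((q ^ (2 * m + 2) : ℝ) : ℂ)) (sq_nonneg q) fun f => by
      refine eLpNorm_le_mul_eLpNorm_of_ae_le_mul (ae_of_all _ fun m => ?_) 2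
      rw [LinearMap.mulLeft_apply, Pi.mul_apply, norm_mul, Complex.norm_real,
        Real.norm_of_nonneg (pow_nonneg hq.1.le _)]
      exact mul_le_mul_of_nonneg_right
        (pow_le_pow_of_le_one hq.1.le hq.2.le (Nat.le_add_left 2 _)) (norm_nonneg _)
  replace hS (f : Lp ℂ 2 (nuMeasure q)) (m : ℕ) : S f m = f (m + 1) := hS f m
  replace hN (f : Lp ℂ 2 (nuMeasure q)) (m : ℕ) :
      N f m = ((q ^ (2 * m + 2) : ℝ) : ℂ) * f m := hN f m
  have hsub (f g : Lp ℂ 2 (nuMeasure q)) (m : ℕ) : (f - g) m = f m - g m :=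
    (ae_nuMeasure_iff hq).1 (Lp.coeFn_sub f g) m
  have hsmul (a : ℂ) (f : Lp ℂ 2 (nuMeasure q)) (m : ℕ) : (a • f) m = a * f m :=
    (ae_nuMeasure_iff hq).1 (Lp.coeFn_smul a f) m
  have hD : IsUnit (1 - S) := isUnit_one_sub_of_norm_lt_one (hS_norm.trans_lt hq.2)
  have hM : IsUnit (1 - N) := isUnit_one_sub_of_norm_lt_one (hN_norm.trans_lt hq2)
  have hM' : IsSelfAdjoint (1 - N) :=
    (IsSelfAdjoint.one _).sub (isSelfAdjoint_of_apply_eq_mul hN)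
  let a : ℝ := -((1 - q ^ 2) ^ 2)⁻¹
  have ha : a ≠ 0 := neg_ne_zero.2 (inv_ne_zero (pow_ne_zero 2 (sub_pos.2 hq2).ne'))
  refine ⟨(a : ℂ) • (star (1 - S) * (1 - N) * (1 - S)), fun f m => ?_, ?_, ?_⟩
  · rw [deltaQ_eq hq, smul_apply, hsmul, star_sub, star_one]
    simp only [mul_apply_eq_comp, sub_apply,
      one_apply_eq_self, hsub, adjoint_shift_apply hq hS, hS, hN, a]
    rcases m with _ | m
    · simp only [if_true]
      push_cast
      ring
    · simp only [Nat.add_eq_zero_iff, one_ne_zero, and_false, if_false, Nat.add_sub_cancel]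
      push_cast
      ring
  · refine IsSelfAdjoint.smul (Complex.conj_ofReal a) ?_
    exact hM'.conjugate' (1 - S)
  · exact (((hD.star.mul hM).mul hD).smul (Units.mk0 (a : ℂ) (by exact_mod_cast ha)))

end
end

section
/- For every ρ ∈ ℂ, the sequence φ_ρ (the q-spherical function) satisfies the eigenvalue equation (Δ φ_ρ)(q^{2m}) = λ(ρ) φ_ρ(q^{2m}) for all m ∈ ℕ, where λ(ρ) = −(1−q^{1+2iρ})(1−q^{1−2iρ})/(1−q²)². -/
open scoped BigOperators
open Complex

noncomputable section

/-- `q^w = exp(w · ln q)` for real `q > 0` and complex `w`. -/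
noncomputable def qpow (q : ℝ) (w : ℂ) : ℂ := Complex.exp (w * (Real.log q : ℂ))

/-- The finite q-Pochhammer symbol `(a;Q)_n = ∏_{j=0}^{n-1} (1 − a Q^j)`. -/
noncomputable def qPoch (a Q : ℂ) (n : ℕ) : ℂ := ∏ j ∈ Finset.range n, (1 - a * Q ^ j)

/-- The infinite q-Pochhammer symbol `(a;Q)_∞ = ∏_{j=0}^{∞} (1 − a Q^j)`. -/
noncomputable def qPochInf (a Q : ℂ) : ℂ := ∏' j : ℕ, (1 - a * Q ^ j)

/-- The eigenvalue `λ(ρ) = −(1−q^{1+2iρ})(1−q^{1−2iρ})/(1−q²)²`. -/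
noncomputable def lambdaQ (q : ℝ) (ρ : ℂ) : ℂ :=
  -((1 - qpow q (1 + 2 * I * ρ)) * (1 - qpow q (1 - 2 * I * ρ))) / (1 - (q : ℂ) ^ 2) ^ 2

/-- The general term of the series defining the Jost-type solution `ψ_ρ(q^{2m})`. -/
noncomputable def psiTerm (q : ℝ) (ρ : ℂ) (m k : ℕ) : ℂ :=
  (qPoch (qpow q (1 - 2 * I * ρ)) ((q : ℂ) ^ 2) k) ^ 2 * (q : ℂ) ^ (2 * k) *
      (q : ℂ) ^ (2 * k * m) /
    (qPoch (qpow q (2 - 4 * I * ρ)) ((q : ℂ) ^ 2) k * qPoch ((q : ℂ) ^ 2) ((q : ℂ) ^ 2) k)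

/-- The Jost-type solution
`ψ_ρ(q^{2m}) = q^{(1−2iρ)m} Σ_{k≥0} ((q^{1−2iρ};q²)_k)² q^{2k} q^{2km} / ((q^{2−4iρ};q²)_k (q²;q²)_k)`. -/
noncomputable def psiQ (q : ℝ) (ρ : ℂ) (m : ℕ) : ℂ :=
  qpow q ((1 - 2 * I * ρ) * (m : ℂ)) * ∑' k : ℕ, psiTerm q ρ m k

/-- The q-spherical function
`φ_ρ(q^{2m}) = Σ_{k=0}^{m} (q^{-2m};q²)_k (q^{1+2iρ};q²)_k (q^{1−2iρ};q²)_k q^{2k} / ((q²;q²)_k)²`. -/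
noncomputable def phiQ (q : ℝ) (ρ : ℂ) (m : ℕ) : ℂ :=
  ∑ k ∈ Finset.range (m + 1),
    qPoch ((q : ℂ) ^ (-(2 * (m : ℤ)))) ((q : ℂ) ^ 2) k *
        qPoch (qpow q (1 + 2 * I * ρ)) ((q : ℂ) ^ 2) k *
        qPoch (qpow q (1 - 2 * I * ρ)) ((q : ℂ) ^ 2) k * (q : ℂ) ^ (2 * k) /
      (qPoch ((q : ℂ) ^ 2) ((q : ℂ) ^ 2) k) ^ 2

lemma qPoch_succ (a Q : ℂ) (n : ℕ) : qPoch a Q (n + 1) = qPoch a Q n * (1 - a * Q ^ n) :=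
  Finset.prod_range_succ _ _

lemma qPoch_succ' (a Q : ℂ) (n : ℕ) : qPoch a Q (n + 1) = (1 - a) * qPoch (a * Q) Q n := by
  simp only [qPoch, Finset.prod_range_succ', pow_zero, mul_one]
  rw [mul_comm]
  congr 1
  exact Finset.prod_congr rfl fun j _ => by ring

lemma one_sub_mul_qPoch_mul (a Q : ℂ) (n : ℕ) :
    (1 - a) * qPoch (a * Q) Q n = qPoch a Q n * (1 - a * Q ^ n) := by
  rw [← qPoch_succ', qPoch_succ]

lemma qPoch_self_ne_zero {Q : ℂ} (hQ : ∀ n : ℕ, Q ^ (n + 1) ≠ 1) (n : ℕ) : qPoch Q Q n ≠ 0 :=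
  Finset.prod_ne_zero_iff.2 fun j _ => by
    rw [← pow_succ']
    exact sub_ne_zero.2 (hQ j).symm

lemma qPoch_eq_zero {a Q : ℂ} {j n : ℕ} (hjn : j < n) (h : a * Q ^ j = 1) : qPoch a Q n = 0 :=
  Finset.prod_eq_zero (Finset.mem_range.2 hjn) (by rw [h, sub_self])

/-- Partial sum of the basic hypergeometric series `₃φ₂(y, a, b; Q, 0; Q, Q)`. -/
def hyperPartialSum (Q a b y : ℂ) (n : ℕ) : ℂ :=
  ∑ k ∈ Finset.range n,
    qPoch y Q k * qPoch a Q k * qPoch b Q k * Q ^ k / (qPoch Q Q k) ^ 2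

lemma hyperPartialSum_succ (Q a b y : ℂ) (n : ℕ) :
    hyperPartialSum Q a b y (n + 1) = hyperPartialSum Q a b y n +
      qPoch y Q n * qPoch a Q n * qPoch b Q n * Q ^ n / (qPoch Q Q n) ^ 2 :=
  Finset.sum_range_succ _ _

/-- The second-order `Q`-difference equation, up to a boundary term, for the partial sums. -/
lemma hyperPartialSum_difference {Q a b x y : ℂ} (hQ : ∀ n : ℕ, Q ^ (n + 1) ≠ 1) (hQ0 : Q ≠ 0)
    (hxy : x * y = 1) (hab : a * b = Q) (n : ℕ) :
    Q * (1 - x) * (hyperPartialSum Q a b (y * Q) (n + 1) - hyperPartialSum Q a b y (n + 1)) -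
        (1 - x * Q) * (hyperPartialSum Q a b y (n + 1) - hyperPartialSum Q a b (y / Q) (n + 1)) +
        (1 - a) * (1 - b) * hyperPartialSum Q a b y (n + 1) =
      qPoch y Q n * qPoch a Q (n + 1) * qPoch b Q (n + 1) / (qPoch Q Q n) ^ 2 := by
  induction n with
  | zero => simp [hyperPartialSum, qPoch]
  | succ n ih =>
    have hup : (1 - x) * qPoch (y * Q) Q (n + 1) =
        (Q ^ (n + 1) - x) * (qPoch y Q n * (1 - y * Q ^ n)) := by
      have h := one_sub_mul_qPoch_mul y Q (n + 1)
      rw [qPoch_succ y] at h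
      linear_combination (-x) * h + (qPoch y Q n * (1 - y * Q ^ n) * Q ^ (n + 1)
        - qPoch (y * Q) Q (n + 1)) * hxy
    have hdown : (1 - x * Q) * qPoch (y / Q) Q (n + 1) =
        (1 - x * Q) * (1 - y / Q) * qPoch y Q n := by
      rw [qPoch_succ', div_mul_cancel₀ _ hQ0, mul_assoc]
    have hy : y = x⁻¹ := eq_inv_of_mul_eq_one_right hxy
    have hx : x ≠ 0 := left_ne_zero_of_mul_eq_one hxy
    have hD := qPoch_self_ne_zero hQ n
    have hn : 1 - Q * Q ^ n ≠ 0 := by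
      rw [← pow_succ']
      exact sub_ne_zero.2 (hQ n).symm
    have hstep (A B C D : ℂ) (E : ℂ) :
        Q * (1 - x) * (A + qPoch (y * Q) Q (n + 1) * E - (B + C * E)) -
          (1 - x * Q) * (B + C * E - (D + qPoch (y / Q) Q (n + 1) * E)) +
          (1 - a) * (1 - b) * (B + C * E) =
        (Q * (1 - x) * (A - B) - (1 - x * Q) * (B - D) + (1 - a) * (1 - b) * B) +
          E * (Q * ((Q ^ (n + 1) - x) * (qPoch y Q n * (1 - y * Q ^ n)) - (1 - x) * C) -
          ((1 - x * Q) * C - (1 - x * Q) * (1 - y / Q) * qPoch y Q n) +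
          (1 - a) * (1 - b) * C) := by
      linear_combination (Q * E) * hup + E * hdown
    have hterm (z : ℂ) : hyperPartialSum Q a b z (n + 1 + 1) = hyperPartialSum Q a b z (n + 1) +
        qPoch z Q (n + 1) *
          (qPoch a Q (n + 1) * qPoch b Q (n + 1) * Q ^ (n + 1) / (qPoch Q Q (n + 1)) ^ 2) := by
      rw [hyperPartialSum_succ]
      ring
    rw [hterm, hterm, hterm, hstep, ih, qPoch_succ a Q (n + 1), qPoch_succ b Q (n + 1),
      qPoch_succ Q Q n, qPoch_succ y Q n, hy]
    generalize qPoch a Q (n + 1) = A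
    generalize qPoch b Q (n + 1) = B
    generalize qPoch Q Q n = D at *
    generalize qPoch x⁻¹ Q n = Y
    subst hab
    rw [pow_succ' _ n]
    generalize (a * b) ^ n = t at *
    have ha : a ≠ 0 := left_ne_zero_of_mul hQ0
    have hb : b ≠ 0 := right_ne_zero_of_mul hQ0
    field_simp
    ring

lemma hyperPartialSum_eq_of_le {Q a b y : ℂ} {m n : ℕ} (hy : y * Q ^ m = 1) (hn : m + 1 ≤ n) :
    hyperPartialSum Q a b y n = hyperPartialSum Q a b y (m + 1) := by
  refine (Finset.sum_subset (Finset.range_mono hn) fun k _ hk => ?_).symm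
  rw [Finset.mem_range, not_lt] at hk
  rw [qPoch_eq_zero hk hy]
  simp

lemma qpow_mul_qpow_eq_sq {q : ℝ} (hq : 0 < q) (ρ : ℂ) :
    qpow q (1 + 2 * I * ρ) * qpow q (1 - 2 * I * ρ) = (q : ℂ) ^ 2 := by
  rw [qpow, qpow, ← Complex.exp_add, ← add_mul]
  ring_nf
  rw [mul_comm, ← Nat.cast_ofNat, Complex.exp_nat_mul, ← Complex.ofReal_exp, Real.exp_log hq]

lemma phiQ_eq_hyperPartialSum {q : ℝ} (hq : q ≠ 0) (ρ : ℂ) {m n : ℕ} (hn : m + 1 ≤ n) :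
    phiQ q ρ m = hyperPartialSum ((q : ℂ) ^ 2) (qpow q (1 + 2 * I * ρ)) (qpow q (1 - 2 * I * ρ))
      (((q : ℂ) ^ 2) ^ m)⁻¹ n := by
  have hq0 : (q : ℂ) ≠ 0 := Complex.ofReal_ne_zero.2 hq
  rw [hyperPartialSum_eq_of_le (inv_mul_cancel₀ (pow_ne_zero m (pow_ne_zero 2 hq0))) hn]
  have hy : (q : ℂ) ^ (-(2 * (m : ℤ))) = (((q : ℂ) ^ 2) ^ m)⁻¹ := by
    rw [zpow_neg, ← pow_mul]
    norm_cast
  simp only [phiQ, hyperPartialSum, hy, pow_mul]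

lemma DeltaQ_eq {q : ℝ} (hq : q ∈ Set.Ioo (0 : ℝ) 1) (f : ℕ → ℂ) (m : ℕ) :
    DeltaQ q f m =
      ((q : ℂ) ^ 2 * (1 - ((q : ℂ) ^ 2) ^ m) * (f (m - 1) - f m) -
        (1 - ((q : ℂ) ^ 2) ^ m * (q : ℂ) ^ 2) * (f m - f (m + 1))) / (1 - (q : ℂ) ^ 2) ^ 2 := by
  have hq0 : (q : ℂ) ≠ 0 := Complex.ofReal_ne_zero.2 hq.1.ne'
  have hq1 : 1 - (q : ℂ) ^ 2 ≠ 0 := by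
    exact_mod_cast (sub_pos.2 (pow_lt_one₀ hq.1.le hq.2 two_ne_zero)).ne'
  have h2 : (q : ℂ) ^ (2 * (m : ℤ)) = ((q : ℂ) ^ 2) ^ m := by
    rw [← pow_mul]
    norm_cast
  have h4 : (q : ℂ) ^ (4 * (m : ℤ)) = (((q : ℂ) ^ 2) ^ m) ^ 2 := by
    rw [← h2, ← zpow_natCast, ← zpow_mul]
    congr 1
    push_cast
    ring
  have hx : ((q : ℂ) ^ 2) ^ m ≠ 0 := pow_ne_zero _ (pow_ne_zero _ hq0)
  have hif : (if m = 0 then (0 : ℂ) else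
        (1 - (q : ℂ) ^ (2 * (m : ℤ))) * (f (m - 1) - f m) /
          ((q : ℂ) ^ (2 * (m : ℤ) - 2) - (q : ℂ) ^ (2 * (m : ℤ)))) =
      (1 - (q : ℂ) ^ (2 * (m : ℤ))) * (f (m - 1) - f m) /
          ((q : ℂ) ^ (2 * (m : ℤ) - 2) - (q : ℂ) ^ (2 * (m : ℤ))) := by
    split_ifs with hm
    · simp [hm]
    · rfl
  rw [DeltaQ, hif, zpow_sub₀ hq0, zpow_sub₀ hq0, zpow_add₀ hq0, zpow_add₀ hq0, h2, h4]
  generalize ((q : ℂ) ^ 2) ^ m = x at *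
  have e1 : x / (q : ℂ) ^ (2 : ℤ) - x = x * (1 - (q : ℂ) ^ 2) / (q : ℂ) ^ 2 := by
    rw [zpow_ofNat]
    field_simp
  have e2 : x - x * (q : ℂ) ^ (2 : ℤ) = x * (1 - (q : ℂ) ^ 2) := by
    rw [zpow_ofNat]
    ring
  have e3 : x / (q : ℂ) ^ (1 : ℤ) - x * (q : ℂ) ^ (1 : ℤ) = x * (1 - (q : ℂ) ^ 2) / q := by
    rw [zpow_one]
    field_simp
  rw [e1, e2, e3, zpow_neg_one, zpow_ofNat]
  field_simp

/-- for every `ρ ∈ ℂ`, the q-spherical function `φ_ρ` satisfies the eigenvalue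
equation `Δ φ_ρ = λ(ρ) φ_ρ` with `λ(ρ) = −(1−q^{1+2iρ})(1−q^{1−2iρ})/(1−q²)²`. -/
theorem phiQ_eigenfunction (q : ℝ) (hq : q ∈ Set.Ioo (0 : ℝ) 1) (ρ : ℂ) :
    ∀ m : ℕ, DeltaQ q (phiQ q ρ) m = lambdaQ q ρ * phiQ q ρ m := by
  intro m
  have hq0 : (q : ℂ) ≠ 0 := Complex.ofReal_ne_zero.2 hq.1.ne'
  have hQ0 : (q : ℂ) ^ 2 ≠ 0 := pow_ne_zero 2 hq0
  have hQ (n : ℕ) : ((q : ℂ) ^ 2) ^ (n + 1) ≠ 1 := by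
    rw [← pow_mul]
    exact_mod_cast (pow_lt_one₀ hq.1.le hq.2 (by positivity : 2 * (n + 1) ≠ 0)).ne
  have hxy : ((q : ℂ) ^ 2) ^ m * (((q : ℂ) ^ 2) ^ m)⁻¹ = 1 :=
    mul_inv_cancel₀ (pow_ne_zero m hQ0)
  have key := hyperPartialSum_difference hQ hQ0 hxy (qpow_mul_qpow_eq_sq hq.1 ρ) (m + 1)
  rw [qPoch_eq_zero m.lt_succ_self ((mul_comm _ _).trans hxy), zero_mul, zero_mul, zero_div,
    ← phiQ_eq_hyperPartialSum hq.1.ne' ρ (by lia : m + 1 ≤ m + 1 + 1)] at key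
  have hsucc : (((q : ℂ) ^ 2) ^ m)⁻¹ / (q : ℂ) ^ 2 = (((q : ℂ) ^ 2) ^ (m + 1))⁻¹ := by
    rw [pow_succ _ m, mul_inv, div_eq_mul_inv]
  rw [hsucc, ← phiQ_eq_hyperPartialSum hq.1.ne' ρ le_rfl] at key
  have hpred : (1 - ((q : ℂ) ^ 2) ^ m) * hyperPartialSum ((q : ℂ) ^ 2) (qpow q (1 + 2 * I * ρ))
      (qpow q (1 - 2 * I * ρ)) ((((q : ℂ) ^ 2) ^ m)⁻¹ * (q : ℂ) ^ 2) (m + 1 + 1) =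
      (1 - ((q : ℂ) ^ 2) ^ m) * phiQ q ρ (m - 1) := by
    cases m with
    | zero => simp
    | succ m =>
      rw [Nat.add_sub_cancel, phiQ_eq_hyperPartialSum hq.1.ne' ρ (by lia : m + 1 ≤ m + 1 + 1 + 1),
        pow_succ _ m, mul_inv, inv_mul_cancel_right₀ hQ0]
  rw [DeltaQ_eq hq, lambdaQ, div_mul_eq_mul_div]
  congr 1
  linear_combination key - (q : ℂ) ^ 2 * hpred

end
end
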